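/- Let F₂ be the free group on two generators a, b, and let ρ: F₂ → SL(2, ℂ) be a group homomorphism. Then for every automorphism θ of F₂, tr ρ(θ(aba⁻¹b⁻¹)) = tr ρ(aba⁻¹b⁻¹). Consequently, the peripheral trace τ = tr ρ(a'b'a'⁻¹b'⁻¹) does not depend on the choice of free basis {a', b'} of F₂. -/

import Mathlib

/-- The trace of an element of `SL(2, ℂ)`. -/
noncomputable def trSL (M : Matrix.SpecialLinearGroup (Fin 2) ℂ) : ℂ :=
  Matrix.trace (M : Matrix (Fin 2) (Fin 2) ℂ)

section

open MvPolynomial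

/-- The commutator `a * b * a⁻¹ * b⁻¹` of the standard generators. -/
def standardCommutator : FreeGroup (Fin 2) :=
  FreeGroup.of 0 * FreeGroup.of 1 * (FreeGroup.of 0)⁻¹ * (FreeGroup.of 1)⁻¹

/-- The traces of `ρ a`, `ρ b` and `ρ (a * b)`, for the standard generators `a`, `b`. -/
noncomputable def traceCoords (ρ : FreeGroup (Fin 2) →* Matrix.SpecialLinearGroup (Fin 2) ℂ) :
    Fin 3 → ℂ :=
  ![trSL (ρ (FreeGroup.of 0)), trSL (ρ (FreeGroup.of 1)),
    trSL (ρ (FreeGroup.of 0 * FreeGroup.of 1))]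

/-- The matrices `1`, `A`, `B`, `A * B`. -/
def wordBasis (A B : Matrix (Fin 2) (Fin 2) ℂ) : Fin 4 → Matrix (Fin 2) (Fin 2) ℂ :=
  ![1, A, B, A * B]

/-- The combination of `1, ρ a, ρ b, ρ (a * b)` with coefficients `p` evaluated at the trace
coordinates of `ρ`. -/
noncomputable def traceCombination
    (ρ : FreeGroup (Fin 2) →* Matrix.SpecialLinearGroup (Fin 2) ℂ)
    (p : Fin 4 → MvPolynomial (Fin 3) ℂ) : Matrix (Fin 2) (Fin 2) ℂ :=
  ∑ i, eval (traceCoords ρ) (p i) • wordBasis (ρ (FreeGroup.of 0)).1 (ρ (FreeGroup.of 1)).1 i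

theorem SpecialLinearGroup.det_eq_one_fin_two (A : Matrix.SpecialLinearGroup (Fin 2) ℂ) :
    A.1 0 0 * A.1 1 1 - A.1 0 1 * A.1 1 0 = 1 := by
  rw [← Matrix.det_fin_two, A.2]

theorem SpecialLinearGroup.mul_self_eq (A : Matrix.SpecialLinearGroup (Fin 2) ℂ) :
    A.1 * A.1 = trSL A • A.1 - 1 := by
  have hA := SpecialLinearGroup.det_eq_one_fin_two A
  ext i j
  fin_cases i <;> fin_cases j <;>
    simp [trSL, Matrix.mul_apply, Matrix.trace_fin_two, Fin.sum_univ_two] <;>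
    first
      | ring1
      | linear_combination -hA

theorem SpecialLinearGroup.coe_inv_eq (A : Matrix.SpecialLinearGroup (Fin 2) ℂ) :
    (A⁻¹).1 = trSL A • 1 - A.1 := by
  ext i j
  fin_cases i <;> fin_cases j <;>
    simp [trSL, Matrix.SpecialLinearGroup.SL2_inv_expl, Matrix.trace_fin_two]

theorem SpecialLinearGroup.mul_swap_eq (A B : Matrix.SpecialLinearGroup (Fin 2) ℂ) :
    B.1 * A.1 = -(A.1 * B.1) + trSL B • A.1 + trSL A • B.1 +
      (trSL (A * B) - trSL A * trSL B) • 1 := by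
  ext i j
  fin_cases i <;> fin_cases j <;>
    simp [trSL, Matrix.mul_apply, Matrix.trace_fin_two, Fin.sum_univ_two] <;> ring

theorem exists_traceCombination_mul_of (i : Fin 2) (p : Fin 4 → MvPolynomial (Fin 3) ℂ) :
    ∃ q : Fin 4 → MvPolynomial (Fin 3) ℂ,
      ∀ ρ : FreeGroup (Fin 2) →* Matrix.SpecialLinearGroup (Fin 2) ℂ,
        traceCombination ρ p * (ρ (FreeGroup.of i)).1 = traceCombination ρ q := by
  fin_cases i
  · refine ⟨![-p 1 + p 2 * (X 2 - X 0 * X 1) - p 3 * X 1, p 0 + p 1 * X 0 + p 2 * X 1 + p 3 * X 2,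
      p 2 * X 0 + p 3, -p 2], fun ρ => ?_⟩
    have hA := SpecialLinearGroup.mul_self_eq (ρ (FreeGroup.of 0))
    have hBA := SpecialLinearGroup.mul_swap_eq (ρ (FreeGroup.of 0)) (ρ (FreeGroup.of 1))
    have hAAB : (ρ (FreeGroup.of 0)).1 * ((ρ (FreeGroup.of 0)).1 * (ρ (FreeGroup.of 1)).1) =
        trSL (ρ (FreeGroup.of 0)) • ((ρ (FreeGroup.of 0)).1 * (ρ (FreeGroup.of 1)).1) -
          (ρ (FreeGroup.of 1)).1 := by
      rw [← mul_assoc, hA, sub_mul, smul_mul_assoc, one_mul]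
    simp [traceCombination, Fin.sum_univ_four, wordBasis, traceCoords, add_mul, mul_add,
      mul_assoc, hA, hBA, hAAB]
    module
  · refine ⟨![-p 2, -p 3, p 0 + p 2 * X 1, p 1 + p 3 * X 1], fun ρ => ?_⟩
    have hB := SpecialLinearGroup.mul_self_eq (ρ (FreeGroup.of 1))
    simp [traceCombination, Fin.sum_univ_four, wordBasis, traceCoords, add_mul, mul_sub,
      mul_assoc, hB]
    module

theorem exists_traceCombination_mul (w : FreeGroup (Fin 2)) :
    ∀ p : Fin 4 → MvPolynomial (Fin 3) ℂ, ∃ q : Fin 4 → MvPolynomial (Fin 3) ℂ,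
      ∀ ρ : FreeGroup (Fin 2) →* Matrix.SpecialLinearGroup (Fin 2) ℂ,
        traceCombination ρ p * (ρ w).1 = traceCombination ρ q := by
  induction w using FreeGroup.induction_on with
  | C1 => exact fun p => ⟨p, fun ρ => by simp⟩
  | of i => exact exists_traceCombination_mul_of i
  | inv_of i _ =>
    intro p
    obtain ⟨q, hq⟩ := exists_traceCombination_mul_of i p
    refine ⟨fun k => X (Fin.castSucc i) * p k - q k, fun ρ => ?_⟩
    have hx : traceCoords ρ (Fin.castSucc i) = trSL (ρ (FreeGroup.of i)) := by
      fin_cases i <;> rfl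
    rw [map_inv, SpecialLinearGroup.coe_inv_eq, mul_sub, hq]
    simp [traceCombination, sub_smul, mul_smul, Finset.smul_sum, hx]
  | mul v w hv hw =>
    intro p
    obtain ⟨q, hq⟩ := hv p
    obtain ⟨r, hr⟩ := hw q
    refine ⟨r, fun ρ => ?_⟩
    rw [map_mul, Matrix.SpecialLinearGroup.coe_mul, ← mul_assoc, hq, hr]

/-- Every `ρ w` is a combination of `1, ρ a, ρ b, ρ (a * b)` whose coefficients are polynomials
in the trace coordinates that do not depend on `ρ`. -/
theorem exists_eq_traceCombination (w : FreeGroup (Fin 2)) :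
    ∃ p : Fin 4 → MvPolynomial (Fin 3) ℂ,
      ∀ ρ : FreeGroup (Fin 2) →* Matrix.SpecialLinearGroup (Fin 2) ℂ,
        (ρ w).1 = traceCombination ρ p := by
  obtain ⟨q, hq⟩ := exists_traceCombination_mul w ![1, 0, 0, 0]
  refine ⟨q, fun ρ => ?_⟩
  rw [← hq]
  simp [traceCombination, Fin.sum_univ_four, wordBasis]

theorem exists_trace_polynomial (w : FreeGroup (Fin 2)) :
    ∃ P : MvPolynomial (Fin 3) ℂ,
      ∀ ρ : FreeGroup (Fin 2) →* Matrix.SpecialLinearGroup (Fin 2) ℂ,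
        trSL (ρ w) = eval (traceCoords ρ) P := by
  obtain ⟨p, hp⟩ := exists_eq_traceCombination w
  refine ⟨2 * p 0 + p 1 * X 0 + p 2 * X 1 + p 3 * X 2, fun ρ => ?_⟩
  rw [trSL, hp]
  simp [traceCombination, Fin.sum_univ_four, wordBasis, traceCoords, trSL]
  ring

/-- The rows are the entries of the four matrices. -/
def flattenMatrices (P : Fin 4 → Matrix (Fin 2) (Fin 2) ℂ) : Matrix (Fin 4) (Fin 4) ℂ :=
  Matrix.of fun i => ![P i 0 0, P i 0 1, P i 1 0, P i 1 1]

theorem det_flattenMatrices_wordBasis (A B : Matrix.SpecialLinearGroup (Fin 2) ℂ) :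
    (flattenMatrices (wordBasis A.1 B.1)).det = 2 - trSL (A * B * A⁻¹ * B⁻¹) := by
  have hA := SpecialLinearGroup.det_eq_one_fin_two A
  have hB := SpecialLinearGroup.det_eq_one_fin_two B
  have hM : flattenMatrices (wordBasis A.1 B.1) =
      !![(1 : Matrix (Fin 2) (Fin 2) ℂ) 0 0, (1 : Matrix (Fin 2) (Fin 2) ℂ) 0 1,
          (1 : Matrix (Fin 2) (Fin 2) ℂ) 1 0, (1 : Matrix (Fin 2) (Fin 2) ℂ) 1 1;
        A.1 0 0, A.1 0 1, A.1 1 0, A.1 1 1;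
        B.1 0 0, B.1 0 1, B.1 1 0, B.1 1 1;
        (A.1 * B.1) 0 0, (A.1 * B.1) 0 1, (A.1 * B.1) 1 0, (A.1 * B.1) 1 1] := by
    ext i j
    fin_cases i <;> rfl
  rw [hM]
  simp [trSL, Matrix.adjugate_fin_two, Matrix.trace_fin_two, Matrix.det_succ_row_zero,
    Fin.sum_univ_succ, Fin.succAbove, Matrix.mul_apply]
  linear_combination 2 * (B.1 0 0 * B.1 1 1 - B.1 0 1 * B.1 1 0) * hA + 2 * hB

theorem flattenMatrices_sum_smul (M : Matrix (Fin 4) (Fin 4) ℂ)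
    (P : Fin 4 → Matrix (Fin 2) (Fin 2) ℂ) :
    flattenMatrices (fun i => ∑ j, M i j • P j) = M * flattenMatrices P := by
  ext i j
  fin_cases j <;> simp [flattenMatrices, Matrix.mul_apply, Matrix.sum_apply]

/-- `tr ρ([θ a, θ b]) - 2` is a multiple of `tr ρ([a, b]) - 2` by a polynomial in the trace
coordinates of `ρ`, for every endomorphism `θ`. -/
theorem exists_trace_commutator_factor (θ : FreeGroup (Fin 2) →* FreeGroup (Fin 2)) :
    ∃ m : MvPolynomial (Fin 3) ℂ,
      ∀ ρ : FreeGroup (Fin 2) →* Matrix.SpecialLinearGroup (Fin 2) ℂ,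
        trSL (ρ (θ standardCommutator)) - 2 =
          eval (traceCoords ρ) m * (trSL (ρ standardCommutator) - 2) := by
  obtain ⟨p, hp⟩ := exists_eq_traceCombination (θ (FreeGroup.of 0))
  obtain ⟨q, hq⟩ := exists_eq_traceCombination (θ (FreeGroup.of 1))
  obtain ⟨r, hr⟩ := exists_eq_traceCombination (θ (FreeGroup.of 0 * FreeGroup.of 1))
  refine ⟨(Matrix.of ![![1, 0, 0, 0], p, q, r]).det, fun ρ => ?_⟩
  simp only [standardCommutator, map_mul, map_inv]
  rw [← neg_inj, ← mul_neg, neg_sub, neg_sub, ← det_flattenMatrices_wordBasis,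
    ← det_flattenMatrices_wordBasis, RingHom.map_det, ← Matrix.det_mul, ← flattenMatrices_sum_smul]
  congr 2
  funext i
  fin_cases i
  · simp [wordBasis, Fin.sum_univ_four]
  · exact hp ρ
  · exact hq ρ
  · have := hr ρ
    rw [map_mul, map_mul, Matrix.SpecialLinearGroup.coe_mul] at this
    exact this

theorem traceCoords_surjective : Function.Surjective traceCoords := by
  intro v
  obtain ⟨s, hs⟩ := IsAlgClosed.exists_pow_nat_eq (v 2 ^ 2 - 4) (n := 2) (by norm_num)
  set u := (v 2 + s) / 2 with hu
  set t := (v 2 - s) / 2 with ht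
  have hut : u * t = 1 := by
    rw [hu, ht]
    linear_combination -hs / 4
  obtain ⟨A, hA⟩ : ∃ A : Matrix.SpecialLinearGroup (Fin 2) ℂ, A.1 = !![v 0, -1; 1, 0] :=
    ⟨⟨_, by simp⟩, rfl⟩
  obtain ⟨B, hB⟩ : ∃ B : Matrix.SpecialLinearGroup (Fin 2) ℂ, B.1 = !![0, u; -t, v 1] :=
    ⟨⟨_, by simp [hut]⟩, rfl⟩
  refine ⟨FreeGroup.lift ![A, B], ?_⟩
  funext i
  fin_cases i
  · simp [traceCoords, trSL, hA]
  · simp [traceCoords, trSL, hB]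
  · simp [traceCoords, trSL, hA, hB, hu, ht]
    ring

/-- The matrix of the quaternion `i`. -/
noncomputable def quaternionI : Matrix.SpecialLinearGroup (Fin 2) ℂ :=
  ⟨!![Complex.I, 0; 0, -Complex.I], by simp⟩

/-- The matrix of the quaternion `j`. -/
noncomputable def quaternionJ : Matrix.SpecialLinearGroup (Fin 2) ℂ :=
  ⟨!![0, 1; -1, 0], by simp⟩

theorem coe_quaternionI : quaternionI.1 = !![Complex.I, 0; 0, -Complex.I] := rfl

theorem coe_quaternionJ : quaternionJ.1 = !![0, 1; -1, 0] := rfl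

/-- The representation sending `a` and `b` to the quaternions `i` and `j`. -/
noncomputable def quaternionRep : FreeGroup (Fin 2) →* Matrix.SpecialLinearGroup (Fin 2) ℂ :=
  FreeGroup.lift ![quaternionI, quaternionJ]

theorem quaternionRep_cases (w : FreeGroup (Fin 2)) :
    ∃ z : ℂ, z ^ 4 = 1 ∧ ((quaternionRep w).1 = !![z, 0; 0, z ^ 3] ∨
      (quaternionRep w).1 = !![0, z; -z ^ 3, 0]) := by
  induction w using FreeGroup.induction_on with
  | C1 => exact ⟨1, by simp, Or.inl (by simp [Matrix.one_fin_two])⟩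
  | of i =>
    fin_cases i
    · exact ⟨Complex.I, by simp, Or.inl (by simp [quaternionRep, coe_quaternionI])⟩
    · exact ⟨1, by simp, Or.inr (by simp [quaternionRep, coe_quaternionJ])⟩
  | inv_of i _ =>
    fin_cases i
    · refine ⟨-Complex.I, by simp [Even.neg_pow (by decide : Even 4)], Or.inl ?_⟩
      rw [Odd.neg_pow (by decide), Complex.I_pow_three]
      simp [quaternionRep, coe_quaternionI, Matrix.adjugate_fin_two]
    · refine ⟨-1, by norm_num, Or.inr ?_⟩
      simp [quaternionRep, coe_quaternionJ, Matrix.adjugate_fin_two]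
      norm_num
  | mul v w hv hw =>
    obtain ⟨x, hx, hv⟩ := hv
    obtain ⟨y, hy, hw⟩ := hw
    rw [map_mul, Matrix.SpecialLinearGroup.coe_mul]
    rcases hv with hv | hv <;> rcases hw with hw | hw <;> rw [hv, hw]
    · exact ⟨x * y, by rw [mul_pow, hx, hy, one_mul], Or.inl (by simp; ring)⟩
    · exact ⟨x * y, by rw [mul_pow, hx, hy, one_mul], Or.inr (by simp; ring)⟩
    · refine ⟨x * y ^ 3, by linear_combination y ^ 12 * hx + (y ^ 8 + y ^ 4 + 1) * hy, Or.inr ?_⟩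
      have h : (x * y ^ 3) ^ 3 = x ^ 3 * y := by
        linear_combination x ^ 3 * y * (y ^ 4 + 1) * hy
      simp [h]
    · refine ⟨-(x * y ^ 3), by linear_combination y ^ 12 * hx + (y ^ 8 + y ^ 4 + 1) * hy,
        Or.inl ?_⟩
      have h : (-(x * y ^ 3)) ^ 3 = -(x ^ 3 * y) := by
        linear_combination -x ^ 3 * y * (y ^ 4 + 1) * hy
      simp [h]

theorem trSL_quaternionRep_commutator (v w : FreeGroup (Fin 2)) :
    trSL (quaternionRep (v * w * v⁻¹ * w⁻¹)) = 2 ∨ trSL (quaternionRep (v * w * v⁻¹ * w⁻¹)) = -2 := by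
  obtain ⟨x, hx, hv⟩ := quaternionRep_cases v
  obtain ⟨y, hy, hw⟩ := quaternionRep_cases w
  have h4 (t z : ℂ) (hz : z ^ 4 = 1) (ht : t = 2 * z ^ 2) : t = 2 ∨ t = -2 := by
    have : (z ^ 2 - 1) * (z ^ 2 + 1) = 0 := by linear_combination hz
    rcases mul_eq_zero.mp this with h | h
    · exact Or.inl (by linear_combination ht + 2 * h)
    · exact Or.inr (by linear_combination ht + 2 * h)
  rw [trSL, map_mul, map_mul, map_mul, map_inv, map_inv, Matrix.SpecialLinearGroup.coe_mul,
    Matrix.SpecialLinearGroup.coe_mul, Matrix.SpecialLinearGroup.coe_mul,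
    Matrix.SpecialLinearGroup.coe_inv, Matrix.SpecialLinearGroup.coe_inv]
  rcases hv with hv | hv <;> rcases hw with hw | hw <;> rw [hv, hw] <;>
    simp [Matrix.adjugate_fin_two]
  · exact h4 _ 1 (one_pow 4) (by linear_combination 2 * y ^ 4 * hx + 2 * hy)
  · exact h4 _ x hx (by linear_combination x ^ 2 * y ^ 4 * hx + 2 * x ^ 2 * hy)
  · exact h4 _ y hy (by linear_combination (y ^ 6 + y ^ 2) * hx + y ^ 2 * hy)
  · exact h4 _ (x * y) (by rw [mul_pow, hx, hy, one_mul])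
      (by linear_combination x ^ 2 * y ^ 2 * (hx + hy))

theorem trSL_quaternionRep_commutator_of :
    trSL (quaternionRep standardCommutator) = -2 := by
  simp [standardCommutator, quaternionRep, trSL, coe_quaternionI, coe_quaternionJ,
    Matrix.adjugate_fin_two]
  norm_num

theorem trSL_map_commutator (θ : FreeGroup (Fin 2) ≃* FreeGroup (Fin 2))
    (ρ : FreeGroup (Fin 2) →* Matrix.SpecialLinearGroup (Fin 2) ℂ) :
    trSL (ρ (θ standardCommutator)) =
      trSL (ρ standardCommutator) := by
  obtain ⟨m, hm⟩ := exists_trace_commutator_factor θ.toMonoidHom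
  obtain ⟨n, hn⟩ := exists_trace_commutator_factor θ.symm.toMonoidHom
  obtain ⟨κ, hκ⟩ := exists_trace_polynomial standardCommutator
  obtain ⟨f₀, hf₀⟩ := exists_trace_polynomial (θ (FreeGroup.of 0))
  obtain ⟨f₁, hf₁⟩ := exists_trace_polynomial (θ (FreeGroup.of 1))
  obtain ⟨f₂, hf₂⟩ := exists_trace_polynomial (θ (FreeGroup.of 0 * FreeGroup.of 1))
  have hf (σ : FreeGroup (Fin 2) →* Matrix.SpecialLinearGroup (Fin 2) ℂ) :
      traceCoords (σ.comp θ.toMonoidHom) = fun i => eval (traceCoords σ) (![f₀, f₁, f₂] i) := by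
    funext i
    fin_cases i
    · exact hf₀ σ
    · exact hf₁ σ
    · exact hf₂ σ
  have hmn (σ : FreeGroup (Fin 2) →* Matrix.SpecialLinearGroup (Fin 2) ℂ) :
      trSL (σ standardCommutator) - 2 =
        eval (traceCoords σ) (bind₁ ![f₀, f₁, f₂] n) * (eval (traceCoords σ) m *
          (trSL (σ standardCommutator) - 2)) := by
    have h := hn (σ.comp θ.toMonoidHom)
    have h' := hm σ
    simp only [MulEquiv.toMonoidHom_eq_coe, MonoidHom.coe_comp, MonoidHom.coe_coe,
      Function.comp_apply, MulEquiv.apply_symm_apply] at h h'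
    rw [← h', h]
    congr 1
    rw [← MulEquiv.toMonoidHom_eq_coe, hf, ← coe_aeval_eq_eval, ← coe_aeval_eq_eval,
      RingHom.coe_coe, RingHom.coe_coe, aeval_bind₁]
  have hq := trSL_quaternionRep_commutator_of
  have hκ2 : κ - 2 ≠ 0 := by
    intro h
    have := hκ quaternionRep
    rw [sub_eq_zero.mp h, hq] at this
    norm_num at this
  have hunit : IsUnit m := by
    refine IsUnit.of_mul_eq_one (bind₁ ![f₀, f₁, f₂] n) (mul_right_cancel₀ hκ2 ?_)
    refine MvPolynomial.funext fun v => ?_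
    obtain ⟨σ, rfl⟩ := traceCoords_surjective v
    have := hmn σ
    rw [hκ] at this
    simp only [map_mul, map_sub, map_one, map_ofNat]
    linear_combination -this
  obtain ⟨c, -, rfl⟩ := isUnit_iff_eq_C_of_isReduced.mp hunit
  have hc : c = 1 := by
    have h1 := hm quaternionRep
    have h2 := hmn quaternionRep
    have h3 := trSL_quaternionRep_commutator (θ (FreeGroup.of 0)) (θ (FreeGroup.of 1))
    simp only [← map_mul, ← map_inv] at h3
    rw [← standardCommutator] at h3
    simp only [eval_C, hq, MulEquiv.toMonoidHom_eq_coe, MonoidHom.coe_coe] at h1 h2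
    rcases h3 with h3 | h3
    · rw [h3] at h1
      have : c = 0 := by linear_combination h1 / 4
      rw [this] at h2
      norm_num at h2
    · rw [h3] at h1
      linear_combination h1 / 4
  have := hm ρ
  rw [hc] at this
  simpa using this

end

/-- for any representation `ρ : F₂ → SL(2,ℂ)` and any automorphism `θ`
of `F₂`, `tr ρ(θ(aba⁻¹b⁻¹)) = tr ρ(aba⁻¹b⁻¹)`; consequently the peripheral trace is
independent of the choice of free basis of `F₂`. -/
theorem peripheral_trace_independent
    (ρ : FreeGroup (Fin 2) →* Matrix.SpecialLinearGroup (Fin 2) ℂ)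
    (a b : FreeGroup (Fin 2)) (ha : a = FreeGroup.of 0) (hb : b = FreeGroup.of 1) :
    (∀ θ : FreeGroup (Fin 2) ≃* FreeGroup (Fin 2),
      trSL (ρ (θ (a * b * a⁻¹ * b⁻¹))) = trSL (ρ (a * b * a⁻¹ * b⁻¹))) ∧
    (∀ a' b' : FreeGroup (Fin 2),
      (∃ θ : FreeGroup (Fin 2) ≃* FreeGroup (Fin 2), θ a = a' ∧ θ b = b') →
      trSL (ρ (a' * b' * a'⁻¹ * b'⁻¹)) = trSL (ρ (a * b * a⁻¹ * b⁻¹))) := by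
  subst ha hb
  refine ⟨fun θ => trSL_map_commutator θ ρ, ?_⟩
  rintro a' b' ⟨θ, rfl, rfl⟩
  have h := trSL_map_commutator θ ρ
  simp only [standardCommutator, map_mul, map_inv] at h
  simpa only [map_mul, map_inv] using h
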